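/- (Second variation of polarity.) Let u(t,x) ∈ C²(ℝ × (ℝⁿ∖{0})) be such that u_t = u(t,·) ∈ S₂(ℝⁿ) for each t, and let w(t,·) = P(u_t) be the fiberwise polar. Then for every t and every y ≠ 0 such that w(t,·) is not linear on the segment [0,y], one has (∂²/∂t²) log w(t,y) = [ −(∂²/∂t²) log u + u · ⟨∇(∂_t log u), (∇²u)⁻¹ ∇(∂_t log u)⟩ ] evaluated at (t, ∇°w(t,·)(y)), where ∇ and ∇² denote gradient and Hessian in the space variable. -/

import Mathlib

open scoped ENNReal RealInnerProductSpace
open Set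

noncomputable section

/-- Euclidean space `ℝⁿ`. -/
abbrev Euc (n : ℕ) := EuclideanSpace ℝ (Fin n)

/-- The polarity transform `𝒫`:
`(Pf)(y) = inf {c ≥ 0 : ⟨x,y⟩ ≤ 1 + c·f(x) for all x}`, with `inf ∅ = ∞`.
(Nonnegativity of `c` is automatic since we work in `ℝ≥0∞`.) -/
def polarT {n : ℕ} (f : Euc n → ℝ≥0∞) (y : Euc n) : ℝ≥0∞ :=
  sInf {c : ℝ≥0∞ | ∀ x : Euc n, ENNReal.ofReal ⟪x, y⟫ ≤ 1 + c * f x}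

/-- The class `Cvx₀(ℝⁿ)` of geometric convex functions: lower semicontinuous, convex,
nonnegative (automatic), vanishing at the origin. -/
def GeomConvexOn {n : ℕ} (f : Euc n → ℝ≥0∞) : Prop :=
  (∀ x y : Euc n, ∀ a b : ℝ, 0 ≤ a → 0 ≤ b → a + b = 1 →
    f (a • x + b • y) ≤ ENNReal.ofReal a * f x + ENNReal.ofReal b * f y) ∧
  LowerSemicontinuous f ∧ f 0 = 0

/-- The polar set `K° = {y : ⟨x,y⟩ ≤ 1 ∀ x ∈ K}`. -/
def polarSet {n : ℕ} (K : Set (Euc n)) : Set (Euc n) :=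
  {y : Euc n | ∀ x ∈ K, ⟪x, y⟫ ≤ 1}

/-- The Legendre transform `(Lf)(y) = sup_x (⟨x,y⟩ - f(x))` of a `[0,∞]`-valued function,
with values in `[0,∞]` (for `f` with `f(0) = 0` the supremum is automatically `≥ 0`,
so the `ℝ≥0∞`-valued truncated subtraction computes the genuine Legendre transform). -/
def legendreT {n : ℕ} (f : Euc n → ℝ≥0∞) (y : Euc n) : ℝ≥0∞ :=
  ⨆ x : Euc n, ENNReal.ofReal ⟪x, y⟫ - f x

/-- The usual subdifferential `∂g(x) = {y : g(z) ≥ g(x) + ⟨z - x, y⟩ ∀ z}`,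
stated in `EReal` to accommodate `[0,∞]`-valued functions. -/
def subdiff {n : ℕ} (g : Euc n → ℝ≥0∞) (x : Euc n) : Set (Euc n) :=
  {y : Euc n | ∀ z : Euc n, (g x : EReal) + ((⟪z - x, y⟫ : ℝ) : EReal) ≤ (g z : EReal)}

/-- The polar subdifferential `∂°f(x) = {y ∈ dom(Pf) : Pf(y)·f(x) = ⟨x,y⟩ - 1}`. -/
def polarSubdiff {n : ℕ} (f : Euc n → ℝ≥0∞) (x : Euc n) : Set (Euc n) :=
  {y : Euc n | polarT f y ≠ ∞ ∧
    (polarT f y : EReal) * (f x : EReal) = ((⟪x, y⟫ - 1 : ℝ) : EReal)}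

/-- `g` restricted to the segment `[0,x]` is linear (i.e. `g(t•x) = c·t` for `t ∈ [0,1]`). -/
def RayLinear {n : ℕ} (g : Euc n → ℝ≥0∞) (x : Euc n) : Prop :=
  ∃ c : ℝ, 0 ≤ c ∧ ∀ t : ℝ, t ∈ Icc (0:ℝ) 1 → g (t • x) = ENNReal.ofReal (c * t)

/-- `g` is not linear on `[0,x+]`: there is no `t > 1` such that `g` is linear on `[0,t•x]`. -/
def NotLinearPlus {n : ℕ} (g : Euc n → ℝ≥0∞) (x : Euc n) : Prop :=
  ¬ ∃ t : ℝ, 1 < t ∧ RayLinear g (t • x)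

/-- `f` is nonlinear at infinity: for every ray `ℝ⁺x`, `t ↦ f(tx)` is finite everywhere and
is not squeezed between `at - b` and `at` for any `a ≥ 0`, `b > 0`. -/
def NonlinearAtInfinity {n : ℕ} (f : Euc n → ℝ≥0∞) : Prop :=
  ∀ x : Euc n, x ≠ 0 →
    (∀ t : ℝ, 0 ≤ t → f (t • x) ≠ ∞) ∧
    ¬ ∃ a b : ℝ, 0 ≤ a ∧ 0 < b ∧ ∀ t : ℝ, 0 ≤ t →
        ENNReal.ofReal (a * t - b) ≤ f (t • x) ∧ f (t • x) ≤ ENNReal.ofReal (a * t)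

/-- The class `S₁(ℝⁿ)`: geometric convex functions which are finite-valued, continuously
differentiable off the origin, and strictly convex. -/
def S1 {n : ℕ} (f : Euc n → ℝ≥0∞) : Prop :=
  GeomConvexOn f ∧ (∀ x, f x ≠ ∞) ∧
  ContDiffOn ℝ 1 (fun x => (f x).toReal) ({0}ᶜ : Set (Euc n)) ∧
  StrictConvexOn ℝ (univ : Set (Euc n)) (fun x => (f x).toReal)

/-- The Hessian of a real-valued function, as the derivative of the gradient map. -/
def hess {n : ℕ} (g : Euc n → ℝ) (x : Euc n) : Euc n →L[ℝ] Euc n :=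
  fderiv ℝ (fun z => gradient g z) x

/-- The class `S₂(ℝⁿ)`: geometric convex functions which are finite-valued, strictly convex,
twice continuously differentiable off the origin with positive definite Hessian there. -/
def S2 {n : ℕ} (f : Euc n → ℝ≥0∞) : Prop :=
  GeomConvexOn f ∧ (∀ x, f x ≠ ∞) ∧
  StrictConvexOn ℝ (univ : Set (Euc n)) (fun x => (f x).toReal) ∧
  ContDiffOn ℝ 2 (fun x => (f x).toReal) ({0}ᶜ : Set (Euc n)) ∧
  ∀ x : Euc n, x ≠ 0 → ∀ v : Euc n, v ≠ 0 →
    0 < ⟪v, hess (fun z => (f z).toReal) x v⟫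

open Topology Filter

theorem ConvexOn.add_fderiv_le {E : Type*} [NormedAddCommGroup E] [NormedSpace ℝ E]
    {f : E → ℝ} (hf : ConvexOn ℝ univ f) {x : E} {f' : E →L[ℝ] ℝ} (hx : HasFDerivAt f f' x)
    (z : E) : f x + f' (z - x) ≤ f z := by
  have hc : ConvexOn ℝ univ (f ∘ AffineMap.lineMap (k := ℝ) x z) := by
    simpa using hf.comp_affineMap (AffineMap.lineMap (k := ℝ) x z)
  have hd : HasDerivAt (f ∘ AffineMap.lineMap (k := ℝ) x z) (f' (z - x)) 0 := by
    have hx' : HasFDerivAt f f' (AffineMap.lineMap (k := ℝ) x z (0 : ℝ)) := by simpa using hx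
    exact hx'.comp_hasDerivAt (0 : ℝ) AffineMap.hasDerivAt_lineMap
  have := hc.le_slope_of_hasDerivAt (mem_univ 0) (mem_univ 1) one_pos hd
  simp only [Function.comp_apply, AffineMap.lineMap_apply_zero, AffineMap.lineMap_apply_one,
    slope_def_field, sub_zero, div_one] at this
  linarith

theorem StrictConvexOn.add_fderiv_lt {E : Type*} [NormedAddCommGroup E] [NormedSpace ℝ E]
    {f : E → ℝ} (hf : StrictConvexOn ℝ univ f) {x : E} {f' : E →L[ℝ] ℝ}
    (hx : HasFDerivAt f f' x) {z : E} (hz : z ≠ x) : f x + f' (z - x) < f z := by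
  have h1 := hf.convexOn.add_fderiv_le hx ((1 / 2 : ℝ) • x + (1 / 2 : ℝ) • z)
  have h2 := hf.2 (mem_univ x) (mem_univ z) hz.symm
    (show (0 : ℝ) < 1 / 2 by norm_num) (show (0 : ℝ) < 1 / 2 by norm_num) (by norm_num)
  have h3 : (1 / 2 : ℝ) • x + (1 / 2 : ℝ) • z - x = (1 / 2 : ℝ) • (z - x) := by module
  rw [h3, map_smul] at h1
  simp only [smul_eq_mul] at h1 h2
  linarith

theorem StrictConvexOn.pos_of_nonneg_of_zero {E : Type*} [AddCommGroup E] [Module ℝ E]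
    {f : E → ℝ} (hf : StrictConvexOn ℝ univ f) (h0 : f 0 = 0) (hnn : ∀ x, 0 ≤ f x)
    {x : E} (hx : x ≠ 0) : 0 < f x := by
  have h2 := hf.2 (mem_univ x) (mem_univ 0) hx
    (show (0 : ℝ) < 1 / 2 by norm_num) (show (0 : ℝ) < 1 / 2 by norm_num) (by norm_num)
  have := hnn ((1 / 2 : ℝ) • x + (1 / 2 : ℝ) • (0 : E))
  simp only [smul_eq_mul, h0] at h2
  linarith

/-- A convex function vanishing at the origin which is continuous and positive away from it grows
at least linearly away from any ball around the origin. -/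
theorem ConvexOn.exists_mul_norm_le {E : Type*} [NormedAddCommGroup E] [NormedSpace ℝ E]
    [FiniteDimensional ℝ E] [Nontrivial E] {f : E → ℝ} (hf : ConvexOn ℝ univ f) (h0 : f 0 = 0)
    (hpos : ∀ x, x ≠ 0 → 0 < f x) (hcont : ContinuousOn f {0}ᶜ) {r : ℝ} (hr : 0 < r) :
    ∃ m, 0 < m ∧ ∀ x, r ≤ ‖x‖ → m * ‖x‖ ≤ f x := by
  have hne : (Metric.sphere (0 : E) r).Nonempty := NormedSpace.sphere_nonempty.2 hr.le
  have hsub : Metric.sphere (0 : E) r ⊆ {0}ᶜ := by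
    rintro x hx rfl
    simp at hx
    linarith
  obtain ⟨x₀, hx₀, hmin⟩ := (isCompact_sphere (0 : E) r).exists_isMinOn hne (hcont.mono hsub)
  refine ⟨f x₀ / r, div_pos (hpos _ (hsub hx₀)) hr, fun x hx => ?_⟩
  have hxp : 0 < ‖x‖ := hr.trans_le hx
  have hmem : (r / ‖x‖) • x ∈ Metric.sphere (0 : E) r := by
    simp [norm_smul, abs_of_pos hr, hxp.ne']
  have h1 : f x₀ ≤ f ((r / ‖x‖) • x) := hmin hmem
  have hle : r / ‖x‖ ≤ 1 := (div_le_one hxp).2 hx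
  have h2 := hf.2 (mem_univ x) (mem_univ 0)
    (show 0 ≤ r / ‖x‖ by positivity) (show 0 ≤ 1 - r / ‖x‖ by linarith) (by ring)
  simp only [smul_zero, add_zero, smul_eq_mul, h0, mul_zero] at h2
  have h3 : f x₀ * ‖x‖ ≤ r * f x := by
    have := h1.trans h2
    rw [div_mul_eq_mul_div, le_div_iff₀ hxp] at this
    exact this
  rw [div_mul_eq_mul_div, div_le_iff₀ hr]
  linarith

/-- The real constants `c ≥ 0` admissible in the definition of the polarity transform. -/
def polarBounds {E : Type*} [NormedAddCommGroup E] [InnerProductSpace ℝ E]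
    (f : E → ℝ) (y : E) : Set ℝ :=
  {c | 0 ≤ c ∧ ∀ z, ⟪z, y⟫ ≤ 1 + c * f z}

theorem polarBounds_nonempty {E : Type*} [NormedAddCommGroup E] [InnerProductSpace ℝ E]
    [FiniteDimensional ℝ E] {f : E → ℝ} (hf : ConvexOn ℝ univ f) (h0 : f 0 = 0)
    (hpos : ∀ x, x ≠ 0 → 0 < f x) (hcont : ContinuousOn f {0}ᶜ) (y : E) :
    (polarBounds f y).Nonempty := by
  have hnn : ∀ x, 0 ≤ f x := fun x => by
    by_cases hx : x = 0
    · rw [hx, h0]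
    · exact (hpos x hx).le
  by_cases hy : y = 0
  · exact ⟨0, le_rfl, fun z => by simp [hy]⟩
  have : Nontrivial E := ⟨y, 0, hy⟩
  have hyp : 0 < ‖y‖ := norm_pos_iff.2 hy
  obtain ⟨m, hm, hmf⟩ := hf.exists_mul_norm_le h0 hpos hcont (inv_pos.2 hyp)
  refine ⟨‖y‖ / m, by positivity, fun z => ?_⟩
  have hzy := real_inner_le_norm z y
  rcases le_total ‖y‖⁻¹ ‖z‖ with hz | hz
  · have h1 := mul_le_mul_of_nonneg_left (hmf z hz) (div_pos hyp hm).le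
    have h2 : ‖y‖ / m * (m * ‖z‖) = ‖z‖ * ‖y‖ := by field_simp
    linarith
  · have h1 : ‖z‖ * ‖y‖ ≤ 1 := by
      calc ‖z‖ * ‖y‖ ≤ ‖y‖⁻¹ * ‖y‖ := by gcongr
        _ = 1 := inv_mul_cancel₀ hyp.ne'
    have := mul_nonneg (div_pos hyp hm).le (hnn z)
    linarith

theorem exists_isLeast_polarBounds {E : Type*} [NormedAddCommGroup E] [InnerProductSpace ℝ E]
    [FiniteDimensional ℝ E] {f : E → ℝ} (hf : ConvexOn ℝ univ f) (h0 : f 0 = 0)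
    (hpos : ∀ x, x ≠ 0 → 0 < f x) (hcont : ContinuousOn f {0}ᶜ) (y : E) :
    ∃ c, IsLeast (polarBounds f y) c := by
  have hcl : IsClosed (polarBounds f y) := by
    have : polarBounds f y = Ici 0 ∩ ⋂ z, {c | ⟪z, y⟫ ≤ 1 + c * f z} := by
      ext c
      simp [polarBounds]
    rw [this]
    exact isClosed_Ici.inter (isClosed_iInter fun z => isClosed_le (by fun_prop) (by fun_prop))
  exact ⟨_, hcl.isLeast_csInf (polarBounds_nonempty hf h0 hpos hcont y) ⟨0, fun c hc => hc.1⟩⟩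

/-- If the supremum defining the polar at `y` is not attained, the polar is linear on `[0, y]`. -/
theorem isLeast_polarBounds_smul {E : Type*} [NormedAddCommGroup E] [InnerProductSpace ℝ E]
    [FiniteDimensional ℝ E] {f : E → ℝ} (hf : ConvexOn ℝ univ f) (h0 : f 0 = 0)
    (hpos : ∀ x, x ≠ 0 → 0 < f x) (hcont : ContinuousOn f {0}ᶜ) {y : E} (hy : y ≠ 0)
    {c : ℝ} (hc : IsLeast (polarBounds f y) c) (hlt : ∀ z, ⟪z, y⟫ < 1 + c * f z)
    {s : ℝ} (hs : s ∈ Icc (0 : ℝ) 1) : IsLeast (polarBounds f (s • y)) (c * s) := by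
  have hnn : ∀ x, 0 ≤ f x := fun x => by
    by_cases hx : x = 0
    · rw [hx, h0]
    · exact (hpos x hx).le
  refine ⟨⟨mul_nonneg hc.1.1 hs.1, fun z => ?_⟩, fun d hd => ?_⟩
  · rw [real_inner_smul_right]
    have := mul_le_mul_of_nonneg_left (hc.1.2 z) hs.1
    nlinarith [hs.2]
  by_contra! hdc
  have hs0 : 0 < s := hs.1.lt_of_ne (by rintro rfl; have := hd.1; simp at hdc; linarith)
  have : Nontrivial E := ⟨y, 0, hy⟩
  have hyp : 0 < ‖y‖ := norm_pos_iff.2 hy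
  obtain ⟨m, hm, hmf⟩ := hf.exists_mul_norm_le h0 hpos hcont (inv_pos.2 hyp)
  have hds : d / s < c := (div_lt_iff₀ hs0).2 hdc
  obtain ⟨c₁, hc₁, hc₁c⟩ := exists_between hds
  have hd0 : 0 ≤ d / s := div_nonneg hd.1 hs0.le
  have hfar : ∃ R, ∀ z, R ≤ ‖z‖ → ⟪z, y⟫ ≤ 1 + c₁ * f z := by
    refine ⟨max ‖y‖⁻¹ (1 / s / (c₁ - d / s) / m), fun z hz => ?_⟩
    have h1 := hmf z ((le_max_left _ _).trans hz)
    have h2 := (le_max_right _ _).trans hz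
    rw [div_le_iff₀ hm, div_le_iff₀ (sub_pos.2 hc₁)] at h2
    have h3 := hd.2 z
    rw [real_inner_smul_right] at h3
    have h4 : ⟪z, y⟫ ≤ 1 / s + d / s * f z := by
      rw [div_mul_eq_mul_div, ← add_div, le_div_iff₀ hs0]
      linarith
    have h5 : ‖z‖ * m * (c₁ - d / s) ≤ f z * (c₁ - d / s) :=
      mul_le_mul_of_nonneg_right (by linarith) (sub_pos.2 hc₁).le
    nlinarith
  obtain ⟨R, hR⟩ := hfar
  have hnear : ∃ c₂ < c, ∀ z, ‖z‖ ≤ R → 1 ≤ ⟪z, y⟫ → ⟪z, y⟫ ≤ 1 + c₂ * f z := by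
    have hK : IsCompact (Metric.closedBall (0 : E) R ∩ {z | 1 ≤ ⟪z, y⟫}) :=
      (isCompact_closedBall _ _).inter_right (isClosed_le (by fun_prop) (by fun_prop))
    have hsub : Metric.closedBall (0 : E) R ∩ {z | 1 ≤ ⟪z, y⟫} ⊆ {0}ᶜ := by
      rintro z ⟨-, hz⟩ rfl
      simp at hz
      linarith
    rcases (Metric.closedBall (0 : E) R ∩ {z | 1 ≤ ⟪z, y⟫}).eq_empty_or_nonempty with he | hne
    · refine ⟨c - 1, by linarith, fun z hz hz' => ?_⟩
      have : z ∈ (∅ : Set E) := he ▸ ⟨by simpa using hz, hz'⟩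
      exact this.elim
    · have hco : ContinuousOn (fun z => (⟪z, y⟫ - 1) / f z)
          (Metric.closedBall (0 : E) R ∩ {z | 1 ≤ ⟪z, y⟫}) :=
        ContinuousOn.div (by fun_prop) (hcont.mono hsub) fun z hz => (hpos z (hsub hz)).ne'
      obtain ⟨z₀, hz₀, hmax⟩ := hK.exists_isMaxOn hne hco
      refine ⟨(⟪z₀, y⟫ - 1) / f z₀, ?_, fun z hz hz' => ?_⟩
      · rw [div_lt_iff₀ (hpos _ (hsub hz₀))]
        linarith [hlt z₀]
      · have hzK : z ∈ Metric.closedBall (0 : E) R ∩ {z | 1 ≤ ⟪z, y⟫} := ⟨by simpa using hz, hz'⟩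
        have h1 : (⟪z, y⟫ - 1) / f z ≤ (⟪z₀, y⟫ - 1) / f z₀ := hmax hzK
        rw [div_le_iff₀ (hpos _ (hsub hzK))] at h1
        linarith
  obtain ⟨c₂, hc₂, hc₂z⟩ := hnear
  have hmem : max c₁ c₂ ∈ polarBounds f y := by
    refine ⟨le_max_of_le_left (hd0.trans hc₁.le), fun z => ?_⟩
    have e1 := mul_le_mul_of_nonneg_right (le_max_left c₁ c₂) (hnn z)
    have e2 := mul_le_mul_of_nonneg_right (le_max_right c₁ c₂) (hnn z)
    rcases le_total R ‖z‖ with h | h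
    · linarith [hR z h]
    rcases le_total 1 ⟪z, y⟫ with h' | h'
    · linarith [hc₂z z h h']
    · have : 0 ≤ c₁ * f z := mul_nonneg (hd0.trans hc₁.le) (hnn z)
      linarith
  have := hc.2 hmem
  exact absurd this (not_le.2 (max_lt hc₁c hc₂))

theorem HasFDerivAt.clm_fderiv {E F : Type*} [NormedAddCommGroup E] [NormedSpace ℝ E]
    [NormedAddCommGroup F] [NormedSpace ℝ F] {f : E → ℝ} {L : E →L[ℝ] E →L[ℝ] ℝ} {x : E}
    (h : HasFDerivAt (fderiv ℝ f) L x) (S : (E →L[ℝ] ℝ) →L[ℝ] F) :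
    HasFDerivAt (fun p => S (fderiv ℝ f p)) (S ∘L L) x :=
  S.hasFDerivAt.comp x h

/-- Second variation at a nondegenerate critical point of `z ↦ (⟪z, y⟫ - 1) / U (s, z)`. -/
theorem second_variation_of_critical {E : Type*} [NormedAddCommGroup E] [InnerProductSpace ℝ E]
    [FiniteDimensional ℝ E] {U : ℝ × E → ℝ} {t : ℝ} {x y : E} (hU : ContDiffAt ℝ 2 U (t, x))
    (hU0 : 0 < U (t, x)) (hk : 1 < ⟪x, y⟫)
    (hcrit : U (t, x) • y = (⟪x, y⟫ - 1) • gradient (fun z => U (t, z)) x)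
    (hpos : ∀ v, v ≠ 0 → 0 < ⟪v, fderiv ℝ (gradient fun z => U (t, z)) x v⟫)
    {w : ℝ → ℝ} (hw : ∀ᶠ p in 𝓝 (t, x),
      U p • y = (⟪p.2, y⟫ - 1) • gradient (fun z => U (p.1, z)) p.2 →
        w p.1 = (⟪p.2, y⟫ - 1) / U p) :
    ∃ q : E,
      fderiv ℝ (gradient fun z => U (t, z)) x q
        = gradient (fun z => deriv (fun s => Real.log (U (s, z))) t) x ∧
      deriv (fun s => deriv (fun r => Real.log (w r)) s) t
        = - deriv (fun s => deriv (fun r => Real.log (U (r, x))) s) t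
          + U (t, x) * ⟪gradient (fun z => deriv (fun s => Real.log (U (s, z))) t) x, q⟫ := by
  have hDU : ContDiffAt ℝ 1 (fderiv ℝ U) (t, x) := hU.fderiv_right (m := 1) (by norm_num)
  have hsymm : IsSymmSndFDerivAt ℝ U (t, x) := hU.isSymmSndFDerivAt (by simp)
  set L := fderiv ℝ (fderiv ℝ U) (t, x) with hL
  have hLd : HasFDerivAt (fderiv ℝ U) L (t, x) := (hDU.differentiableAt one_ne_zero).hasFDerivAt
  -- restriction of a covector on the product to the second factor, as a vector
  let S : (ℝ × E →L[ℝ] ℝ) →L[ℝ] E :=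
    LinearMap.toContinuousLinearMap
      { toFun := fun l => (InnerProductSpace.toDual ℝ E).symm (l ∘L ContinuousLinearMap.inr ℝ ℝ E)
        map_add' := fun l l' => by rw [ContinuousLinearMap.add_comp, map_add]
        map_smul' := fun a l => by simp [ContinuousLinearMap.smul_comp] }
  have hS : ∀ (l : ℝ × E →L[ℝ] ℝ) (v : E), ⟪S l, v⟫ = l (0, v) := fun l v => by
    simp [S, InnerProductSpace.toDual_symm_apply]
  have hgrad_eq : ∀ {g : E → ℝ} {z : E} {l : ℝ × E →L[ℝ] ℝ},
      HasFDerivAt g (l ∘L ContinuousLinearMap.inr ℝ ℝ E) z → gradient g z = S l := by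
    intro g z l hg
    refine ext_inner_right ℝ fun v => ?_
    rw [hS, ← InnerProductSpace.toDual_apply_apply, toDual_gradient, hg.fderiv]
    simp
  have hslice : ∀ {V : ℝ × E → ℝ} {p : ℝ × E}, DifferentiableAt ℝ V p →
      gradient (fun z => V (p.1, z)) p.2 = S (fderiv ℝ V p) := by
    intro V p hV
    exact hgrad_eq (hV.hasFDerivAt.comp p.2 (hasFDerivAt_prodMk_right p.1 p.2))
  have hgood : ∀ᶠ p in 𝓝 (t, x), DifferentiableAt ℝ U p ∧ 0 < U p ∧ 1 < ⟪p.2, y⟫ := by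
    have e1 : ∀ᶠ p in 𝓝 (t, x), DifferentiableAt ℝ U p :=
      (hU.eventually (by simp)).mono fun p hp => hp.differentiableAt two_ne_zero
    have e2 : ∀ᶠ p in 𝓝 (t, x), 0 < U p := hU.continuousAt.eventually (lt_mem_nhds hU0)
    have hin : ContinuousAt (fun p : ℝ × E => ⟪p.2, y⟫) (t, x) := by fun_prop
    have e3 : ∀ᶠ p in 𝓝 (t, x), 1 < ⟪p.2, y⟫ := hin.eventually (lt_mem_nhds hk)
    filter_upwards [e1, e2, e3] with p h1 h2 h3 using ⟨h1, h2, h3⟩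
  have hUd : DifferentiableAt ℝ U (t, x) := hgood.self_of_nhds.1
  have hzx : Tendsto (fun z : E => (t, z)) (𝓝 x) (𝓝 (t, x)) :=
    (Continuous.prodMk_right t).tendsto x
  have hst : Tendsto (fun s : ℝ => (s, x)) (𝓝 t) (𝓝 (t, x)) :=
    (Continuous.prodMk_left x).tendsto t
  -- the Hessian in the space variable
  have hH : ∀ v, fderiv ℝ (gradient fun z => U (t, z)) x v = S (L (0, v)) := by
    intro v
    have hev : (gradient fun z => U (t, z)) =ᶠ[𝓝 x] fun z => S (fderiv ℝ U (t, z)) := by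
      filter_upwards [hzx.eventually hgood] with z hz
      exact hslice hz.1
    have hd : HasFDerivAt (fun z => S (fderiv ℝ U (t, z)))
        (S ∘L L ∘L ContinuousLinearMap.inr ℝ ℝ E) x :=
      (hLd.clm_fderiv S).comp x (hasFDerivAt_prodMk_right t x)
    rw [hev.fderiv_eq, hd.fderiv]
    simp
  simp only [hH] at hpos ⊢
  have hinj : ∀ v, S (L (0, v)) = 0 → v = 0 := by
    intro v hv
    by_contra hne
    have := hpos v hne
    simp [hv] at this
  set A := S (fderiv ℝ U (t, x)) with hA
  set k := ⟪x, y⟫ - 1 with hkdef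
  have hk0 : 0 < k := by linarith
  rw [show gradient (fun z => U (t, z)) x = A from hslice hUd] at hcrit
  -- the logarithmic time derivative
  let h : ℝ × E → ℝ := fun p => fderiv ℝ U p (1, 0) / U p
  have htime : ∀ p, DifferentiableAt ℝ U p → 0 < U p →
      deriv (fun r => Real.log (U (r, p.2))) p.1 = h p := by
    intro p hp hp0
    have hd : HasDerivAt (fun r : ℝ => U (r, p.2)) (fderiv ℝ U p (1, 0)) p.1 :=
      HasFDerivAt.comp_hasDerivAt (x := p.1) (f := fun r : ℝ => (r, p.2)) (l := U) hp.hasFDerivAt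
        ((hasDerivAt_id p.1).prodMk (hasDerivAt_const p.1 p.2))
    exact (hd.log hp0.ne').deriv
  have hhd : HasFDerivAt h (((U (t, x)) ^ 2)⁻¹ •
      (U (t, x) • (ContinuousLinearMap.apply ℝ ℝ ((1 : ℝ), (0 : E)) ∘L L)
        - fderiv ℝ U (t, x) (1, 0) • fderiv ℝ U (t, x))) (t, x) := by
    have h1 : HasFDerivAt (fun p => fderiv ℝ U p (1, 0))
        (ContinuousLinearMap.apply ℝ ℝ ((1 : ℝ), (0 : E)) ∘L L) (t, x) :=
      (ContinuousLinearMap.apply ℝ ℝ ((1 : ℝ), (0 : E))).hasFDerivAt.comp (t, x) hLd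
    have h2 := h1.mul ((hasDerivAt_inv hU0.ne').comp_hasFDerivAt (t, x) hUd.hasFDerivAt)
    refine h2.congr_fderiv ?_
    refine ContinuousLinearMap.ext fun p => ?_
    simp
    field_simp
    ring
  have hgrad : gradient (fun z => deriv (fun s => Real.log (U (s, z))) t) x
      = S (fderiv ℝ h (t, x)) := by
    have hev : (fun z => deriv (fun s => Real.log (U (s, z))) t) =ᶠ[𝓝 x] fun z => h (t, z) := by
      filter_upwards [hzx.eventually hgood] with z hz
      exact htime (t, z) hz.1 hz.2.1
    rw [← hslice hhd.differentiableAt]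
    simp only [gradient, hev.fderiv_eq]
  have hgrad' : (U (t, x)) ^ 2 • S (fderiv ℝ h (t, x))
      = U (t, x) • S (L (1, 0)) - fderiv ℝ U (t, x) (1, 0) • A := by
    refine ext_inner_right ℝ fun v => ?_
    rw [inner_sub_left, real_inner_smul_left, real_inner_smul_left, real_inner_smul_left, hA,
      hS, hS, hS, hhd.fderiv, hsymm.eq (1, 0) (0, v)]
    simp only [smul_apply, sub_apply,
      ContinuousLinearMap.comp_apply, ContinuousLinearMap.apply_apply, smul_eq_mul, ← hL]
    field_simp
  rw [hgrad]
  -- the space Hessian is invertible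
  let T : E →L[ℝ] E := S ∘L L ∘L ContinuousLinearMap.inr ℝ ℝ E
  have hT : ∀ v, T v = S (L (0, v)) := fun v => by simp [T]
  have hTinj : Function.Injective T := by
    rw [injective_iff_map_eq_zero]
    exact fun v hv => hinj v (by rw [← hT, hv])
  have hTsurj : Function.Surjective T := LinearMap.surjective_of_injective (f := T.toLinearMap) hTinj
  obtain ⟨q, hq⟩ := hTsurj (S (fderiv ℝ h (t, x)))
  refine ⟨q, by rw [← hT, hq], ?_⟩
  -- the critical point equation and its implicit solution
  let G : ℝ × E → E := fun p => U p • y - (⟪p.2, y⟫ - 1) • S (fderiv ℝ U p)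
  have hGc : ContDiffAt ℝ 1 G (t, x) := by
    refine ContDiffAt.sub ((hU.of_le (by norm_num)).smul contDiffAt_const) (ContDiffAt.smul ?_ ?_)
    · exact (contDiffAt_snd.inner ℝ contDiffAt_const).sub contDiffAt_const
    · exact S.contDiff.contDiffAt.comp (t, x) hDU
  have hGd : ∀ a v, fderiv ℝ G (t, x) (a, v)
      = fderiv ℝ U (t, x) (a, v) • y - (k • S (L (a, v)) + ⟪v, y⟫ • A) := by
    intro a v
    have h1 : HasFDerivAt (fun p => U p • y) ((fderiv ℝ U (t, x)).smulRight y) (t, x) :=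
      hUd.hasFDerivAt.smul_const y
    have h2 : HasFDerivAt (fun p : ℝ × E => ⟪p.2, y⟫ - 1)
        ((innerSL ℝ y) ∘L ContinuousLinearMap.snd ℝ ℝ E) (t, x) := by
      have := ((innerSL ℝ y).hasFDerivAt.comp (t, x) hasFDerivAt_snd).sub_const 1
      refine this.congr_of_eventuallyEq (Eventually.of_forall fun p => ?_)
      simp [real_inner_comm]
    have h3 : HasFDerivAt (fun p => S (fderiv ℝ U p)) (S ∘L L) (t, x) :=
      hLd.clm_fderiv S
    have h4 := (h1.sub (h2.smul h3)).fderiv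
    have h5 : fderiv ℝ G (t, x) = _ := h4
    rw [h5]
    simp [hkdef, hA, real_inner_comm]
  have hyA : y = (k / U (t, x)) • A := by
    rw [div_eq_inv_mul, mul_smul, ← hcrit, smul_smul, inv_mul_cancel₀ hU0.ne', one_smul]
  have hGv : ∀ v, fderiv ℝ G (t, x) (0, v) = -(k • T v) := by
    intro v
    have e1 : fderiv ℝ U (t, x) (0, v) = ⟪A, v⟫ := (hS _ v).symm
    have e2 : ⟪v, y⟫ = k / U (t, x) * ⟪A, v⟫ := by
      rw [real_inner_comm]
      conv_lhs => rw [hyA]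
      rw [real_inner_smul_left]
    rw [hGd, e1, e2, hT]
    conv_lhs => rw [hyA]
    module
  have hinv : (fderiv ℝ G (t, x) ∘L .inr ℝ ℝ E).IsInvertible := by
    have hi : Function.Injective (fderiv ℝ G (t, x) ∘L .inr ℝ ℝ E) := by
      rw [injective_iff_map_eq_zero]
      intro v hv
      have : k • T v = 0 := by simpa [hGv] using hv
      exact (injective_iff_map_eq_zero T).1 hTinj v ((smul_eq_zero.1 this).resolve_left hk0.ne')
    have hb : Function.Bijective (fderiv ℝ G (t, x) ∘L .inr ℝ ℝ E) :=
      ⟨hi, LinearMap.surjective_of_injective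
        (f := (fderiv ℝ G (t, x) ∘L .inr ℝ ℝ E).toLinearMap) hi⟩
    exact ⟨ContinuousLinearEquiv.ofBijective _ (LinearMap.ker_eq_bot.2 hb.1)
      (LinearMap.range_eq_top.2 hb.2), by ext; simp⟩
  let X := hGc.implicitFunction one_ne_zero hinv
  have hXt : X t = x := hGc.implicitFunction_apply_self one_ne_zero hinv
  have hXc : ContDiffAt ℝ 1 X t := hGc.contDiffAt_implicitFunction one_ne_zero hinv
  have hG0 : G (t, x) = 0 := sub_eq_zero.2 hcrit
  have hXG : ∀ᶠ s in 𝓝 t, G (s, X s) = 0 := by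
    simpa [hG0] using hGc.eventually_apply_implicitFunction one_ne_zero hinv
  have hγ : ∀ s, DifferentiableAt ℝ X s → HasDerivAt (fun s => (s, X s)) (1, deriv X s) s :=
    fun s hs => (hasDerivAt_id s).prodMk hs.hasDerivAt
  have hXd : DifferentiableAt ℝ X t := hXc.differentiableAt one_ne_zero
  have hγt : Tendsto (fun s => (s, X s)) (𝓝 t) (𝓝 (t, x)) := by
    have := (hγ t hXd).continuousAt.tendsto
    rwa [hXt] at this
  have hXde : ∀ᶠ s in 𝓝 t, DifferentiableAt ℝ X s :=
    (hXc.eventually (by simp)).mono fun s hs => hs.differentiableAt one_ne_zero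
  have hγx := hγ t hXd
  -- velocity of the critical point
  have hX' : deriv X t = -(U (t, x) • q) := by
    have h1 : HasDerivAt (fun s => G (s, X s)) (fderiv ℝ G (t, x) (1, deriv X t)) t := by
      refine HasFDerivAt.comp_hasDerivAt (l := G) t ?_ hγx
      rw [hXt]
      exact (hGc.differentiableAt one_ne_zero).hasFDerivAt
    have h2 : fderiv ℝ G (t, x) (1, deriv X t) = 0 := by
      rw [← h1.deriv]
      have : (fun s => G (s, X s)) =ᶠ[𝓝 t] fun _ => 0 := hXG
      rw [this.deriv_eq, deriv_const]
    have h3 : ((1 : ℝ), deriv X t) = (1, 0) + (0, deriv X t) := by simp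
    rw [h3, map_add, hGv, hGd, inner_zero_left, zero_smul, add_zero] at h2
    apply hTinj
    rw [map_neg, map_smul, hq]
    have h4 : k • T (deriv X t) = k • -(U (t, x) • S (fderiv ℝ h (t, x))) := by
      have h5 : k • T (deriv X t)
          = fderiv ℝ U (t, x) (1, 0) • y - k • S (L (1, 0)) := by
        rw [← sub_eq_add_neg, sub_eq_zero] at h2
        exact h2.symm
      have h6 : U (t, x) • S (fderiv ℝ h (t, x))
          = S (L (1, 0)) - (fderiv ℝ U (t, x) (1, 0) / U (t, x)) • A := by
        have := congrArg (fun v => (U (t, x))⁻¹ • v) hgrad'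
        simp only [smul_sub, smul_smul] at this
        rw [inv_mul_cancel₀ hU0.ne', one_smul, sq, inv_mul_cancel_left₀ hU0.ne',
          inv_mul_eq_div] at this
        exact this
      rw [h5, h6]
      conv_lhs => rw [hyA]
      module
    exact smul_right_injective E hk0.ne' h4
  -- first variation along the critical curve
  have hfirst : (fun s => deriv (fun r => Real.log (w r)) s) =ᶠ[𝓝 t] fun s => -h (s, X s) := by
    have hlog : ∀ᶠ s in 𝓝 t, Real.log (w s)
        = Real.log (⟪X s, y⟫ - 1) - Real.log (U (s, X s)) := by
      filter_upwards [hγt.eventually hgood, hγt.eventually hw, hXG] with s h1 h2 h3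
      rw [h2 (by rw [hslice h1.1]; exact sub_eq_zero.1 h3),
        Real.log_div (sub_pos.2 h1.2.2).ne' h1.2.1.ne']
    filter_upwards [hlog.eventually_nhds, hγt.eventually hgood, hXG, hXde] with s h1 h2 h3 h4
    obtain ⟨hd, hp, hin⟩ := h2
    have h5 : (fun r => Real.log (w r)) =ᶠ[𝓝 s] _ := h1
    rw [h5.deriv_eq]
    have h6 : HasDerivAt (fun r => ⟪X r, y⟫ - 1) ⟪deriv X s, y⟫ s := by
      simpa using (h4.hasDerivAt.inner ℝ (hasDerivAt_const s y)).sub_const 1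
    have h7 : HasDerivAt (fun r => U (r, X r)) (fderiv ℝ U (s, X s) (1, deriv X s)) s :=
      HasFDerivAt.comp_hasDerivAt (l := U) s hd.hasFDerivAt (hγ s h4)
    have h8 := ((h6.log (sub_pos.2 hin).ne').sub (h7.log hp.ne')).deriv
    have h9 : deriv (fun r => Real.log (⟪X r, y⟫ - 1) - Real.log (U (r, X r))) s = _ := h8
    rw [h9]
    have h10 : fderiv ℝ U (s, X s) (1, deriv X s)
        = fderiv ℝ U (s, X s) (1, 0) + ⟪S (fderiv ℝ U (s, X s)), deriv X s⟫ := by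
      rw [hS, ← map_add]
      simp
    have h11 : U (s, X s) * ⟪deriv X s, y⟫
        = (⟪X s, y⟫ - 1) * ⟪S (fderiv ℝ U (s, X s)), deriv X s⟫ := by
      have := congrArg (fun v => ⟪v, deriv X s⟫) (sub_eq_zero.1 h3)
      simp only [real_inner_smul_left] at this
      rw [real_inner_comm, this]
    have h12 : (⟪X s, y⟫ - 1) ≠ 0 := (sub_pos.2 hin).ne'
    rw [h10]
    simp only [h]
    have hp' := hp.ne'
    rw [div_sub_div _ _ h12 hp', ← neg_div, div_eq_div_iff (mul_ne_zero h12 hp') hp']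
    linear_combination U (s, X s) * h11
  have hsecond : (fun s => deriv (fun r => Real.log (U (r, x))) s) =ᶠ[𝓝 t] fun s => h (s, x) := by
    filter_upwards [hst.eventually hgood] with s hs
    exact htime (s, x) hs.1 hs.2.1
  have hhd' := hhd.differentiableAt.hasFDerivAt
  have d1 : HasDerivAt (fun s => h (s, x)) (fderiv ℝ h (t, x) (1, 0)) t :=
    HasFDerivAt.comp_hasDerivAt (l := h) t hhd' ((hasDerivAt_id t).prodMk (hasDerivAt_const t x))
  have d2 : HasDerivAt (fun s => -h (s, X s)) (-fderiv ℝ h (t, x) (1, deriv X t)) t := by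
    refine HasDerivAt.fun_neg (HasFDerivAt.comp_hasDerivAt (l := h) t ?_ hγx)
    rwa [hXt]
  rw [hfirst.deriv_eq, hsecond.deriv_eq, d1.deriv, d2.deriv, hS]
  have h3 : ((1 : ℝ), deriv X t) = (1, 0) + (0, deriv X t) := by simp
  have h4 : ((0 : ℝ), -(U (t, x) • q)) = (-U (t, x)) • ((0 : ℝ), q) := by simp
  rw [h3, map_add, hX', h4, map_smul, smul_eq_mul]
  ring

theorem mem_polarT_iff {n : ℕ} {f : Euc n → ℝ≥0∞} (hfin : ∀ x, f x ≠ ∞) {y : Euc n} {c : ℝ}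
    (hc : 0 ≤ c) : (∀ x, ENNReal.ofReal ⟪x, y⟫ ≤ 1 + ENNReal.ofReal c * f x) ↔
      ∀ x, ⟪x, y⟫ ≤ 1 + c * (f x).toReal := by
  refine forall_congr' fun x => ?_
  have h0 : 0 ≤ c * (f x).toReal := mul_nonneg hc ENNReal.toReal_nonneg
  rw [← ENNReal.ofReal_toReal (hfin x), ← ENNReal.ofReal_mul hc, ← ENNReal.ofReal_one,
    ← ENNReal.ofReal_add zero_le_one h0, ENNReal.ofReal_le_ofReal_iff (by positivity),
    ENNReal.toReal_ofReal ENNReal.toReal_nonneg]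

theorem polarT_eq_ofReal {n : ℕ} {f : Euc n → ℝ≥0∞} (hfin : ∀ x, f x ≠ ∞) {y : Euc n} {c : ℝ}
    (hc : IsLeast (polarBounds (fun x => (f x).toReal) y) c) : polarT f y = ENNReal.ofReal c := by
  refine IsLeast.csInf_eq ⟨(mem_polarT_iff hfin hc.1.1).2 hc.1.2, fun d hd => ?_⟩
  rcases eq_or_ne d ∞ with rfl | hd'
  · exact le_top
  rw [← ENNReal.ofReal_toReal hd'] at hd ⊢
  exact ENNReal.ofReal_le_ofReal
    (hc.2 ⟨ENNReal.toReal_nonneg, (mem_polarT_iff hfin ENNReal.toReal_nonneg).1 hd⟩)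

theorem isLeast_polarBounds_of_eq {E : Type*} [NormedAddCommGroup E] [InnerProductSpace ℝ E]
    {f : E → ℝ} {y x : E} {c : ℝ} (hc : c ∈ polarBounds f y) (hx : ⟪x, y⟫ = 1 + c * f x)
    (hfx : 0 < f x) : IsLeast (polarBounds f y) c :=
  ⟨hc, fun d hd => le_of_mul_le_mul_right (by linarith [hd.2 x]) hfx⟩

theorem pos_of_mem_polarBounds {E : Type*} [NormedAddCommGroup E] [InnerProductSpace ℝ E]
    {f : E → ℝ} {y : E} (hy : y ≠ 0) {c : ℝ} (hc : c ∈ polarBounds f y) : 0 < c := by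
  refine hc.1.lt_of_ne ?_
  rintro rfl
  have hyp : ‖y‖ ^ 2 ≠ 0 := pow_ne_zero 2 (norm_ne_zero_iff.2 hy)
  have := hc.2 ((2 / ‖y‖ ^ 2) • y)
  rw [real_inner_smul_left, real_inner_self_eq_norm_sq, div_mul_cancel₀ _ hyp] at this
  norm_num at this

section S2

variable {n : ℕ} {f : Euc n → ℝ≥0∞}

theorem S2.toReal_zero (hf : S2 f) : (f 0).toReal = 0 := by
  rw [hf.1.2.2, ENNReal.toReal_zero]

theorem S2.toReal_pos (hf : S2 f) {x : Euc n} (hx : x ≠ 0) : 0 < (f x).toReal :=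
  hf.2.2.1.pos_of_nonneg_of_zero hf.toReal_zero (fun _ => ENNReal.toReal_nonneg) hx

theorem S2.continuousOn (hf : S2 f) : ContinuousOn (fun x => (f x).toReal) {0}ᶜ :=
  hf.2.2.2.1.continuousOn

theorem S2.differentiableAt (hf : S2 f) {x : Euc n} (hx : x ≠ 0) :
    DifferentiableAt ℝ (fun x => (f x).toReal) x :=
  (hf.2.2.2.1.contDiffAt (isOpen_compl_singleton.mem_nhds hx)).differentiableAt two_ne_zero

theorem S2.exists_isLeast (hf : S2 f) (y : Euc n) :
    ∃ c, IsLeast (polarBounds (fun x => (f x).toReal) y) c :=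
  exists_isLeast_polarBounds hf.2.2.1.convexOn hf.toReal_zero (fun _ => hf.toReal_pos)
    hf.continuousOn y

theorem S2.polarT_polarT (hf : S2 f) (x : Euc n) : polarT (polarT f) x = f x := by
  apply le_antisymm
  · refine sInf_le fun y => ?_
    obtain ⟨c, hc⟩ := hf.exists_isLeast y
    rw [polarT_eq_ofReal hf.2.1 hc, mul_comm, real_inner_comm]
    exact (mem_polarT_iff hf.2.1 hc.1.1).2 hc.1.2 x
  · by_cases hx : x = 0
    · rw [hx, hf.1.2.2]
      exact zero_le
    refine le_sInf fun c hc => ?_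
    rcases eq_or_ne c ∞ with rfl | hcfin
    · exact le_top
    have hd := (hf.differentiableAt hx).hasGradientAt
    set g := gradient (fun x => (f x).toReal) x
    have htan : ∀ z, (f x).toReal + ⟪g, z - x⟫ ≤ (f z).toReal := fun z => by
      simpa using hf.2.2.1.convexOn.add_fderiv_le hd.hasFDerivAt z
    have ha : 0 < ⟪g, x⟫ - (f x).toReal := by
      have := hf.2.2.1.add_fderiv_lt hd.hasFDerivAt (Ne.symm hx)
      simp [hf.1.2.2] at this
      linarith
    set a := ⟪g, x⟫ - (f x).toReal with ha'
    have hP : polarT f (a⁻¹ • g) ≤ ENNReal.ofReal a⁻¹ := by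
      refine sInf_le ((mem_polarT_iff hf.2.1 (inv_pos.2 ha).le).2 fun z => ?_)
      have h1 := htan z
      rw [inner_sub_right] at h1
      rw [real_inner_smul_right, real_inner_comm, inv_mul_eq_div, inv_mul_eq_div, div_le_iff₀ ha,
        add_mul, div_mul_cancel₀ _ ha.ne']
      linarith
    have h1 : ENNReal.ofReal ⟪a⁻¹ • g, x⟫ ≤ 1 + ENNReal.ofReal (c.toReal * a⁻¹) := by
      rw [ENNReal.ofReal_mul ENNReal.toReal_nonneg, ENNReal.ofReal_toReal hcfin]
      exact (hc (a⁻¹ • g)).trans (by gcongr)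
    have hnn : 0 ≤ c.toReal * a⁻¹ := mul_nonneg ENNReal.toReal_nonneg (inv_pos.2 ha).le
    rw [← ENNReal.ofReal_one, ← ENNReal.ofReal_add zero_le_one hnn,
      ENNReal.ofReal_le_ofReal_iff (by positivity), real_inner_smul_left, inv_mul_eq_div,
      div_le_iff₀ ha, add_mul, inv_mul_cancel_right₀ ha.ne'] at h1
    rw [← ENNReal.toReal_le_toReal (hf.2.1 x) hcfin]
    linarith

theorem S2.mem_polarSubdiff_polarT_iff (hf : S2 f) {x y : Euc n} {c : ℝ}
    (hc : IsLeast (polarBounds (fun x => (f x).toReal) y) c) :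
    x ∈ polarSubdiff (polarT f) y ↔ ⟪x, y⟫ = 1 + c * (f x).toReal := by
  have h1 : ((ENNReal.ofReal c : ℝ≥0∞) : EReal) = (c : EReal) := by
    rw [EReal.coe_ennreal_ofReal, max_eq_left hc.1.1]
  simp only [polarSubdiff, mem_ofPred_eq]
  rw [hf.polarT_polarT x, polarT_eq_ofReal hf.2.1 hc, h1, ← EReal.coe_ennreal_toReal (hf.2.1 x),
    ← EReal.coe_mul, EReal.coe_eq_coe_iff, real_inner_comm]
  refine ⟨fun h => by linarith [h.2], fun h => ⟨hf.2.1 x, by linarith⟩⟩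

theorem S2.exists_polarSubdiff_polarT_eq_singleton (hf : S2 f) {y : Euc n} (hy : y ≠ 0)
    (hlin : ¬ RayLinear (polarT f) y) :
    ∃ x c, x ≠ 0 ∧ 0 < c ∧ IsLeast (polarBounds (fun x => (f x).toReal) y) c ∧
      ⟪x, y⟫ = 1 + c * (f x).toReal ∧ polarSubdiff (polarT f) y = {x} := by
  obtain ⟨c, hc⟩ := hf.exists_isLeast y
  have hc0 := pos_of_mem_polarBounds hy hc.1
  obtain ⟨x, hx⟩ : ∃ x, ⟪x, y⟫ = 1 + c * (f x).toReal := by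
    by_contra! hne
    refine hlin ⟨c, hc.1.1, fun s hs => polarT_eq_ofReal hf.2.1 ?_⟩
    exact isLeast_polarBounds_smul hf.2.2.1.convexOn hf.toReal_zero (fun _ => hf.toReal_pos)
      hf.continuousOn hy hc (fun z => (hc.1.2 z).lt_of_ne (hne z)) hs
  have hx0 : x ≠ 0 := by
    rintro rfl
    simp [hf.1.2.2] at hx
  refine ⟨x, c, hx0, hc0, hc, hx, ?_⟩
  ext x'
  rw [hf.mem_polarSubdiff_polarT_iff hc, mem_singleton_iff]
  refine ⟨fun hx' => ?_, fun h => h ▸ hx⟩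
  by_contra hne
  have h2 := hf.2.2.1.2 (mem_univ x) (mem_univ x') (Ne.symm hne)
    (show (0 : ℝ) < 1 / 2 by norm_num) (show (0 : ℝ) < 1 / 2 by norm_num) (by norm_num)
  have h3 := hc.1.2 ((1 / 2 : ℝ) • x + (1 / 2 : ℝ) • x')
  rw [inner_add_left, real_inner_smul_left, real_inner_smul_left, hx, hx'] at h3
  have h4 := mul_lt_mul_of_pos_left h2 hc0
  simp only [smul_eq_mul] at h3 h4
  linarith

/-- A solution of the critical point equation computes the polar. -/
theorem S2.polarT_toReal_of_critical (hf : S2 f) {x y : Euc n} (hk : 1 < ⟪x, y⟫)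
    (hcrit : (f x).toReal • y = (⟪x, y⟫ - 1) • gradient (fun z => (f z).toReal) x) :
    (polarT f y).toReal = (⟪x, y⟫ - 1) / (f x).toReal := by
  have hx : x ≠ 0 := by
    rintro rfl
    simp at hk
    linarith
  have hfx := hf.toReal_pos hx
  have hk0 : 0 < ⟪x, y⟫ - 1 := sub_pos.2 hk
  have hc0 := div_pos hk0 hfx
  have hd := (hf.differentiableAt hx).hasGradientAt
  set g := gradient (fun z => (f z).toReal) x
  have hmem : (⟪x, y⟫ - 1) / (f x).toReal ∈ polarBounds (fun z => (f z).toReal) y := by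
    refine ⟨hc0.le, fun z => ?_⟩
    have h1 : (f x).toReal + ⟪g, z - x⟫ ≤ (f z).toReal := by
      simpa using hf.2.2.1.convexOn.add_fderiv_le hd.hasFDerivAt z
    have h2 := congrArg (fun v => ⟪v, z - x⟫) hcrit
    simp only [real_inner_smul_left] at h2
    have h3 : ⟪y, z - x⟫ = ⟪z, y⟫ - ⟪x, y⟫ := by
      rw [inner_sub_right, real_inner_comm, real_inner_comm y x]
    rw [h3] at h2
    have h4 := mul_le_mul_of_nonneg_left h1 hk0.le
    have h5 : ⟪z, y⟫ - 1 ≤ (⟪x, y⟫ - 1) * (f z).toReal / (f x).toReal := by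
      rw [le_div_iff₀ hfx]
      linarith
    rw [div_mul_eq_mul_div]
    linarith
  rw [polarT_eq_ofReal hf.2.1 (isLeast_polarBounds_of_eq hmem (x := x) ?_ hfx),
    ENNReal.toReal_ofReal hc0.le]
  rw [div_mul_cancel₀ _ hfx.ne']
  ring

/-- A point attaining the polar solves the critical point equation. -/
theorem S2.critical_of_mem_polarBounds (hf : S2 f) {x y : Euc n} (hx : x ≠ 0) {c : ℝ}
    (hc : c ∈ polarBounds (fun z => (f z).toReal) y) (hxc : ⟪x, y⟫ = 1 + c * (f x).toReal) :
    (f x).toReal • y = (⟪x, y⟫ - 1) • gradient (fun z => (f z).toReal) x := by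
  have hd := (hf.differentiableAt hx).hasGradientAt
  set g := gradient (fun z => (f z).toReal) x
  have hmin : IsLocalMin (fun z => c * (f z).toReal - ⟪y, z⟫) x := by
    refine Filter.Eventually.of_forall fun z => ?_
    have := hc.2 z
    rw [real_inner_comm] at this hxc
    simp only
    linarith
  have h1 : HasFDerivAt (fun z => c * (f z).toReal - ⟪y, z⟫)
      (c • InnerProductSpace.toDual ℝ (Euc n) g - innerSL ℝ y) x :=
    (hd.hasFDerivAt.const_mul c).sub (innerSL ℝ y).hasFDerivAt
  have h2 := hmin.hasFDerivAt_eq_zero h1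
  have h3 : c • g = y := by
    refine ext_inner_right ℝ fun v => ?_
    have := DFunLike.congr_fun h2 v
    simp at this
    rw [real_inner_smul_left]
    linarith
  rw [hxc, add_sub_cancel_left, mul_comm c, mul_smul, h3]

end S2

/-- Theorem 5.4 (second variation of polarity): with `w(t,·) = P(u(t,·))`, at every `t` and
`y` with `w(t,·)` not linear on `[0,y]`,
`∂ₜ² log w(t,y) = [-∂ₜ² log u + u ⟨∇(∂ₜ log u), (∇²u)⁻¹ ∇(∂ₜ log u)⟩]` at `(t, ∇°w(t,·)(y))`,
where `q` with `∇²u(t,·)(x) q = ∇(∂ₜ log u)(t,x)` realizes the inverse Hessian. -/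
theorem stmt_13 {n : ℕ} (u : ℝ → Euc n → ℝ≥0∞) (hu : ∀ t : ℝ, S2 (u t))
    (hC2 : ContDiffOn ℝ 2 (fun p : ℝ × Euc n => (u p.1 p.2).toReal)
      {p : ℝ × Euc n | p.2 ≠ 0})
    (t : ℝ) (y : Euc n) (hy : y ≠ 0)
    (hlin : ¬ RayLinear (polarT (u t)) y) :
    ∃ x q : Euc n,
      polarSubdiff (polarT (u t)) y = {x} ∧
      hess (fun z => (u t z).toReal) x q
        = gradient (fun z => deriv (fun s => Real.log ((u s z).toReal)) t) x ∧
      deriv (fun s => deriv (fun r => Real.log ((polarT (u r) y).toReal)) s) t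
        = - deriv (fun s => deriv (fun r => Real.log ((u r x).toReal)) s) t
          + (u t x).toReal *
            ⟪gradient (fun z => deriv (fun s => Real.log ((u s z).toReal)) t) x, q⟫ := by
  obtain ⟨x, c, hx, hc0, hc, hxc, hsing⟩ :=
    (hu t).exists_polarSubdiff_polarT_eq_singleton hy hlin
  have hopen : IsOpen {p : ℝ × Euc n | p.2 ≠ 0} :=
    isOpen_compl_singleton.preimage continuous_snd
  have hk : 1 < ⟪x, y⟫ := by
    have := mul_pos hc0 ((hu t).toReal_pos hx)
    linarith
  obtain ⟨q, hq, hform⟩ := second_variation_of_critical (y := y)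
    (hC2.contDiffAt (hopen.mem_nhds (show (t, x).2 ≠ 0 from hx)))
    ((hu t).toReal_pos hx) hk ((hu t).critical_of_mem_polarBounds hx hc.1 hxc)
    ((hu t).2.2.2.2 x hx) (w := fun r => (polarT (u r) y).toReal) (by
      have hin : ContinuousAt (fun p : ℝ × Euc n => ⟪p.2, y⟫) (t, x) := by fun_prop
      filter_upwards [hin.eventually (lt_mem_nhds hk)] with p hp hcrit
      exact (hu p.1).polarT_toReal_of_critical hp hcrit)
  exact ⟨x, q, hsing, hq, hform⟩
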